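/- Let k ≤ n and m be positive integers, let W ∈ ℤ^{m×n} be totally unimodular, and let w ∈ ℤᵐ. Let S = {x ∈ ℤⁿ : Wx ≤ w}, let q₁,…,q_k > 0 and h ∈ ℝⁿ, and define f(x) = Σ_{i=1}^k (−q_i x_i²) + Σ_{i=1}^n h_i x_i. Suppose x* ∈ S satisfies f(x*) ≤ f(x) for all x ∈ S. For each i = 1,…,k suppose l_i = min{x_i : x ∈ S} and u_i = max{x_i : x ∈ S} exist, let γ = max{q_i(u_i − l_i)² : i = 1,…,k}, let ε ∈ (0,1], and let g > 0 be a real number with u_i − l_i ≥ g for all i = 1,…,k and g² ≥ k(1 + 1/ε). Then for every x◇ ∈ S with f(x◇) − f(x*) ≤ γk/(4g²), there exists x^Υ ∈ S such that f(x◇) − f(x*) ≤ ε (f(x^Υ) − f(x*)); in particular, if f attains its maximum value f_max on S, then f(x◇) − f(x*) ≤ ε (f_max − f(x*)), i.e., x◇ is an ε-approximate solution. -/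

import Mathlib

open Matrix in
/-- If the rows in `T` of a totally unimodular matrix have trivial common kernel, a real vector on
which all these rows take integer values is integral. -/
lemma Matrix.IsTotallyUnimodular.exists_eq_intCast {ι : Type*} [Finite ι] {n : ℕ}
    {A : Matrix ι (Fin n) ℤ} (hA : A.IsTotallyUnimodular) (x : Fin n → ℝ) (T : Set ι)
    (hT : ∀ j ∈ T, ∃ z : ℤ, (A.map (Int.cast : ℤ → ℝ) *ᵥ x) j = z)
    (hinj : ∀ v : Fin n → ℝ, (∀ j ∈ T, (A.map (Int.cast : ℤ → ℝ) *ᵥ v) j = 0) → v = 0) :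
    ∃ y : Fin n → ℤ, x = fun i => (y i : ℝ) := by
  have : Fintype T := Fintype.ofFinite T
  set B : Matrix T (Fin n) ℝ := (A.map (Int.cast : ℤ → ℝ)).submatrix Subtype.val id with hB
  have hBinj : Function.Injective B.mulVecLin := by
    rw [injective_iff_map_eq_zero]
    exact fun v hv => hinj v fun j hj => congrFun hv ⟨j, hj⟩
  have hrank : Module.finrank ℝ (Submodule.span ℝ (Set.range B.row)) = n := by
    rw [← rank_eq_finrank_span_row, Matrix.rank, LinearMap.finrank_range_of_inj hBinj]
    simp
  obtain ⟨b, hb, -, hbind⟩ := Submodule.exists_fun_fin_finrank_span_eq ℝ (Set.range B.row)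
  choose r hr using hb
  set c : Fin n → T := r ∘ finCongr hrank.symm
  have hind : LinearIndependent ℝ (B.submatrix c id).row := by
    have : (B.submatrix c id).row = b ∘ finCongr hrank.symm := by
      funext i
      exact hr _
    rw [this]
    exact hbind.comp _ (finCongr hrank.symm).injective
  set C : Matrix (Fin n) (Fin n) ℤ := A.submatrix (Subtype.val ∘ c) id
  have hCB : B.submatrix c id = C.map (Int.cast : ℤ → ℝ) := rfl
  rw [linearIndependent_rows_iff_isUnit, hCB] at hind
  have hdet : ((C.det : ℤ) : ℝ) ≠ 0 := by
    have := ((isUnit_iff_isUnit_det _).1 hind).ne_zero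
    rwa [← Int.cast_det] at this
  have hCunit : IsUnit C.det := by
    obtain ⟨s, hs⟩ := (isTotallyUnimodular_iff A).1 hA n (Subtype.val ∘ c) id
    change (s : ℤ) = C.det at hs
    rcases s with _ | _ | _ <;> simp [← hs] at hdet ⊢
  choose z hz using fun i => hT (c i) (c i).2
  refine ⟨C⁻¹ *ᵥ z, mulVec_injective_of_isUnit hind ?_⟩
  have hCy : C *ᵥ (C⁻¹ *ᵥ z) = z := by
    rw [mulVec_mulVec, mul_nonsing_inv _ hCunit, one_mulVec]
  funext i
  have h₁ : (C.map (Int.cast : ℤ → ℝ) *ᵥ x) i = z i := hz i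
  rw [h₁, ← congrFun hCy i]
  simp [mulVec, dotProduct]

/-- Starting from `p` and moving in a nonzero direction `d`, one can move until some coordinate
becomes an integer without any coordinate crossing an integer. -/
lemma exists_step_to_int {ι : Type*} [Finite ι] (p d : ι → ℝ) (hd : d ≠ 0) :
    ∃ t : ℝ, (∀ j, ⌊p j⌋ ≤ p j + t * d j ∧ p j + t * d j ≤ ⌈p j⌉) ∧
      ∃ j, d j ≠ 0 ∧ ∃ z : ℤ, p j + t * d j = z := by
  set e : ι → ℤ := fun j => if 0 < d j then ⌈p j⌉ else ⌊p j⌋ with he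
  set τ : ι → ℝ := fun j => (e j - p j) / d j with hτ
  have hτ_nonneg : ∀ j, 0 ≤ τ j := fun j => by
    simp only [hτ, he]
    split_ifs with hj
    · exact div_nonneg (sub_nonneg.2 (Int.le_ceil _)) hj.le
    · exact div_nonneg_of_nonpos (sub_nonpos.2 (Int.floor_le _)) (not_lt.1 hj)
  obtain ⟨j₁, hj₁⟩ := Function.ne_iff.1 hd
  obtain ⟨j₀, hj₀, hmin⟩ :=
    Set.exists_min_image {j | d j ≠ 0} τ (Set.toFinite _) ⟨j₁, hj₁⟩
  refine ⟨τ j₀, fun j => ?_, j₀, hj₀, e j₀, ?_⟩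
  · have hfl := Int.floor_le (p j)
    have hce := Int.le_ceil (p j)
    have h0 := hτ_nonneg j₀
    rcases eq_or_ne (d j) 0 with hj | hj
    · simp [hj, hfl, hce]
    · have hle := hmin j hj
      have hτj : τ j * d j = e j - p j := div_mul_cancel₀ _ hj
      rcases lt_or_gt_of_ne hj with hneg | hpos
      · rw [show e j = ⌊p j⌋ from if_neg hneg.not_gt] at hτj
        constructor <;> nlinarith
      · rw [show e j = ⌈p j⌉ from if_pos hpos] at hτj
        constructor <;> nlinarith
  · rw [show τ j₀ * d j₀ = e j₀ - p j₀ from div_mul_cancel₀ _ hj₀]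
    ring

open Matrix in
/-- Rounding with respect to a totally unimodular matrix with trivial kernel: there is an integer
point whose image is a coordinatewise rounding of the image of the given real point. -/
lemma Matrix.IsTotallyUnimodular.exists_rounding_of_injective {ι : Type*} [Finite ι] {n : ℕ}
    {A : Matrix ι (Fin n) ℤ} (hA : A.IsTotallyUnimodular)
    (hinj : ∀ v : Fin n → ℝ, A.map (Int.cast : ℤ → ℝ) *ᵥ v = 0 → v = 0) (x : Fin n → ℝ) :
    ∃ y : Fin n → ℤ, ∀ j, ⌊(A.map (Int.cast : ℤ → ℝ) *ᵥ x) j⌋ ≤ (A *ᵥ y) j ∧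
      (A *ᵥ y) j ≤ ⌈(A.map (Int.cast : ℤ → ℝ) *ᵥ x) j⌉ := by
  set R := A.map (Int.cast : ℤ → ℝ) with hR
  induction hN : {j | ¬ ∃ z : ℤ, (R *ᵥ x) j = z}.ncard using Nat.strong_induction_on
    generalizing x with
  | _ N ih =>
    by_cases hker : ∀ v : Fin n → ℝ, (∀ j ∈ {j | ∃ z : ℤ, (R *ᵥ x) j = z}, (R *ᵥ v) j = 0) → v = 0
    · obtain ⟨y, rfl⟩ := hA.exists_eq_intCast x {j | ∃ z : ℤ, (R *ᵥ x) j = z} (fun j hj => hj) hker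
      refine ⟨y, fun j => ?_⟩
      have : (R *ᵥ fun i => (y i : ℝ)) j = ((A *ᵥ y) j : ℤ) := by
        simp [hR, mulVec, dotProduct]
      simp [this]
    · push Not at hker
      obtain ⟨v, hv, hv0⟩ := hker
      obtain ⟨t, ht, j₀, hj₀, z₀, hz₀⟩ := exists_step_to_int (R *ᵥ x) (R *ᵥ v)
        (fun h0 => hv0 (hinj v h0))
      have hx' : ∀ j, (R *ᵥ (x + t • v)) j = (R *ᵥ x) j + t * (R *ᵥ v) j := fun j => by
        simp [mulVec_add, mulVec_smul]
      obtain ⟨y, hy⟩ := ih _ (by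
        rw [← hN]
        refine Set.ncard_lt_ncard ⟨fun j hj => ?_, fun hsub => ?_⟩ (Set.toFinite _)
        · rintro ⟨z, hz⟩
          exact hj ⟨z, by rw [hx', hv j ⟨z, hz⟩, mul_zero, add_zero, hz]⟩
        · exact hsub (a := j₀) (fun hz => hj₀ (hv j₀ hz)) ⟨z₀, by rw [hx', hz₀]⟩) (x + t • v) rfl
      refine ⟨y, fun j => ⟨le_trans (Int.le_floor.2 ?_) (hy j).1,
        (hy j).2.trans (Int.ceil_le.2 ?_)⟩⟩
      · rw [hx']; exact (ht j).1
      · rw [hx']; exact (ht j).2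

open Matrix in
/-- Rounding with respect to a totally unimodular matrix: a real point can be rounded to an integer
point whose image rounds the image of the original point. -/
lemma Matrix.IsTotallyUnimodular.exists_rounding {ι : Type*} [Finite ι] {n : ℕ}
    {A : Matrix ι (Fin n) ℤ} (hA : A.IsTotallyUnimodular) (x : Fin n → ℝ) :
    ∃ y : Fin n → ℤ, (∀ i, ⌊x i⌋ ≤ y i ∧ y i ≤ ⌈x i⌉) ∧
      ∀ j, (A *ᵥ y) j ≤ ⌈(A.map (Int.cast : ℤ → ℝ) *ᵥ x) j⌉ ∧
        ⌊(A.map (Int.cast : ℤ → ℝ) *ᵥ x) j⌋ ≤ (A *ᵥ y) j := by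
  have hmap : (fromRows A (1 : Matrix (Fin n) (Fin n) ℤ)).map (Int.cast : ℤ → ℝ) =
      fromRows (A.map (Int.cast : ℤ → ℝ)) 1 := by
    ext (i | i) j <;> simp [Matrix.one_apply]
  obtain ⟨y, hy⟩ := hA.fromRows_one.exists_rounding_of_injective (fun v hv => by
    rw [hmap, fromRows_mulVec] at hv
    funext i
    simpa using congrFun hv (Sum.inr i)) x
  rw [hmap, fromRows_mulVec, fromRows_mulVec] at hy
  exact ⟨y, fun i => by simpa using hy (Sum.inr i), fun j => by simpa using (hy (Sum.inl j)).symm⟩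

open Matrix in
/-- The sum of two integer solutions of a totally unimodular system splits into two
integer solutions that differ by at most one in every coordinate. -/
lemma Matrix.IsTotallyUnimodular.exists_balanced_split {ι : Type*} [Finite ι] {n : ℕ}
    {A : Matrix ι (Fin n) ℤ} (hA : A.IsTotallyUnimodular) (w : ι → ℤ) (a b : Fin n → ℤ)
    (ha : ∀ j, (A *ᵥ a) j ≤ w j) (hb : ∀ j, (A *ᵥ b) j ≤ w j) :
    ∃ y z : Fin n → ℤ, y + z = a + b ∧ (∀ i, |y i - z i| ≤ 1) ∧
      (∀ j, (A *ᵥ y) j ≤ w j) ∧ ∀ j, (A *ᵥ z) j ≤ w j := by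
  obtain ⟨y, hy, hAy⟩ := hA.exists_rounding fun i => ((a i + b i : ℤ) : ℝ) / 2
  have hAx : ∀ j, (A.map (Int.cast : ℤ → ℝ) *ᵥ fun i => ((a i + b i : ℤ) : ℝ) / 2) j =
      (((A *ᵥ a) j + (A *ᵥ b) j : ℤ) : ℝ) / 2 := fun j => by
    simp [Matrix.mulVec, dotProduct, ← Finset.sum_add_distrib, Finset.sum_div, mul_add, add_div,
      mul_div_assoc]
  have hfloor : ∀ s : ℤ, s - 1 ≤ 2 * ⌊(s : ℝ) / 2⌋ := fun s => by
    have := Int.lt_floor_add_one ((s : ℝ) / 2)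
    have : (s : ℝ) < 2 * ⌊(s : ℝ) / 2⌋ + 2 := by linarith
    have : s < 2 * ⌊(s : ℝ) / 2⌋ + 2 := by exact_mod_cast this
    omega
  have hceil : ∀ s : ℤ, 2 * ⌈(s : ℝ) / 2⌉ ≤ s + 1 := fun s => by
    have := Int.ceil_lt_add_one ((s : ℝ) / 2)
    have : 2 * (⌈(s : ℝ) / 2⌉ : ℝ) < s + 2 := by linarith
    have : 2 * ⌈(s : ℝ) / 2⌉ < s + 2 := by exact_mod_cast this
    omega
  refine ⟨y, a + b - y, by abel, fun i => ?_, fun j => ?_, fun j => ?_⟩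
  · have h₁ := hfloor (a i + b i)
    have h₂ := hceil (a i + b i)
    have h₃ := hy i
    simp only [Pi.sub_apply, Pi.add_apply, abs_le]
    omega
  · have h₁ := (hAx j ▸ hAy j).1
    have h₂ := hceil ((A *ᵥ a) j + (A *ᵥ b) j)
    have := ha j
    have := hb j
    omega
  · have h₁ := (hAx j ▸ hAy j).2
    have h₂ := hfloor ((A *ᵥ a) j + (A *ᵥ b) j)
    have := ha j
    have := hb j
    simp only [Matrix.mulVec_sub, Matrix.mulVec_add, Pi.sub_apply, Pi.add_apply]
    omega


/-- TU case: any feasible point within `γk/(4g²)` of the minimum is an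
`ε`-approximate solution, when `g² ≥ k(1 + 1/ε)`. -/
theorem stmt_14 (k n m : ℕ) (hk : 0 < k) (hkn : k ≤ n) (hm : 0 < m)
    (W : Matrix (Fin m) (Fin n) ℤ)
    (hTU : ∀ (s : ℕ) (r : Fin s → Fin m) (c : Fin s → Fin n),
      Function.Injective r → Function.Injective c →
      (W.submatrix r c).det = 0 ∨ (W.submatrix r c).det = 1 ∨ (W.submatrix r c).det = -1)
    (w : Fin m → ℤ)
    (S : Set (Fin n → ℝ))
    (hS : S = {x | (∀ i, ∃ z : ℤ, x i = (z : ℝ)) ∧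
                   ∀ j, (∑ i, (W j i : ℝ) * x i) ≤ (w j : ℝ)})
    (q : Fin k → ℝ) (hq : ∀ i, 0 < q i) (h : Fin n → ℝ)
    (f : (Fin n → ℝ) → ℝ)
    (hf : ∀ x, f x = (∑ i : Fin k, -(q i) * (x (Fin.castLE hkn i)) ^ 2) + ∑ i, h i * x i)
    (xstar : Fin n → ℝ) (hxstarS : xstar ∈ S) (hxstar : ∀ x ∈ S, f xstar ≤ f x)
    (l u : Fin k → ℝ)
    (hl : ∀ i, (∃ y ∈ S, y (Fin.castLE hkn i) = l i) ∧ ∀ y ∈ S, l i ≤ y (Fin.castLE hkn i))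
    (hu : ∀ i, (∃ y ∈ S, y (Fin.castLE hkn i) = u i) ∧ ∀ y ∈ S, y (Fin.castLE hkn i) ≤ u i)
    (γ : ℝ)
    (hγmax : ∀ i, q i * (u i - l i) ^ 2 ≤ γ) (hγatt : ∃ i, γ = q i * (u i - l i) ^ 2)
    (ε : ℝ) (hε0 : 0 < ε) (hε1 : ε ≤ 1)
    (g : ℝ) (hg : 0 < g) (hgap : ∀ i, g ≤ u i - l i)
    (hg2 : g ^ 2 ≥ k * (1 + 1 / ε))
    (xd : Fin n → ℝ) (hxdS : xd ∈ S)
    (hxd : f xd - f xstar ≤ γ * k / (4 * g ^ 2)) :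
    (∃ xY ∈ S, f xd - f xstar ≤ ε * (f xY - f xstar)) ∧
    (∀ fmax : ℝ, (∃ y ∈ S, f y = fmax) → (∀ x ∈ S, f x ≤ fmax) →
      f xd - f xstar ≤ ε * (fmax - f xstar)) := by
  have hTU' : W.IsTotallyUnimodular := fun s r c hr hc => by
    rcases hTU s r c hr hc with h0 | h0 | h0
    · exact ⟨0, by simp [h0]⟩
    · exact ⟨1, by simp [h0]⟩
    · exact ⟨-1, by simp [h0]⟩
  have hmem : ∀ a : Fin n → ℤ, (fun i => (a i : ℝ)) ∈ S ↔ ∀ j, (W.mulVec a) j ≤ w j := fun a => by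
    rw [hS]
    simp only [Set.mem_ofPred_eq, Matrix.mulVec, dotProduct]
    exact ⟨fun ha j => by exact_mod_cast ha.2 j,
      fun ha => ⟨fun i => ⟨a i, rfl⟩, fun j => by exact_mod_cast ha j⟩⟩
  have hlift : ∀ x ∈ S, ∃ a : Fin n → ℤ, x = fun i => (a i : ℝ) := fun x hx => by
    rw [hS] at hx
    choose a ha using hx.1
    exact ⟨a, funext ha⟩
  obtain ⟨p, hp⟩ := hγatt
  obtain ⟨⟨xl, hxl, hxlp⟩, -⟩ := hl p
  obtain ⟨⟨xu, hxu, hxup⟩, -⟩ := hu p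
  have hfl := hxstar xl hxl
  have hfu := hxstar xu hxu
  obtain ⟨a, rfl⟩ := hlift xl hxl
  obtain ⟨b, rfl⟩ := hlift xu hxu
  obtain ⟨y, z, hyz, hyz1, hy, hz⟩ :=
    hTU'.exists_balanced_split w a b ((hmem a).1 hxl) ((hmem b).1 hxu)
  rw [← hmem] at hy hz
  have hsum : ∀ i, (y i : ℝ) + z i = a i + b i := fun i => by exact_mod_cast congrFun hyz i
  have hg2pos : 0 < g ^ 2 := by positivity
  have hpar : f (fun i => (y i : ℝ)) + f (fun i => (z i : ℝ)) -
      (f (fun i => (a i : ℝ)) + f (fun i => (b i : ℝ))) =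
      (∑ i : Fin k, q i * ((a (Fin.castLE hkn i) : ℝ) - b (Fin.castLE hkn i)) ^ 2 / 2) -
      ∑ i : Fin k, q i * ((y (Fin.castLE hkn i) : ℝ) - z (Fin.castLE hkn i)) ^ 2 / 2 := by
    have hlin : ∑ i, h i * (y i : ℝ) + ∑ i, h i * (z i : ℝ) =
        ∑ i, h i * (a i : ℝ) + ∑ i, h i * (b i : ℝ) := by
      simp only [← Finset.sum_add_distrib, ← mul_add, hsum]
    have hquad : (∑ i : Fin k, -(q i) * (y (Fin.castLE hkn i) : ℝ) ^ 2) +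
        (∑ i : Fin k, -(q i) * (z (Fin.castLE hkn i) : ℝ) ^ 2) -
        ((∑ i : Fin k, -(q i) * (a (Fin.castLE hkn i) : ℝ) ^ 2) +
        ∑ i : Fin k, -(q i) * (b (Fin.castLE hkn i) : ℝ) ^ 2) =
      (∑ i : Fin k, q i * ((a (Fin.castLE hkn i) : ℝ) - b (Fin.castLE hkn i)) ^ 2 / 2) -
      ∑ i : Fin k, q i * ((y (Fin.castLE hkn i) : ℝ) - z (Fin.castLE hkn i)) ^ 2 / 2 := by
      simp only [← Finset.sum_add_distrib, ← Finset.sum_sub_distrib]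
      refine Finset.sum_congr rfl fun i _ => ?_
      linear_combination (-(q i) / 2) * ((y (Fin.castLE hkn i) : ℝ) + z (Fin.castLE hkn i) +
        a (Fin.castLE hkn i) + b (Fin.castLE hkn i)) * hsum (Fin.castLE hkn i)
    simp only [hf]
    linarith
  have hgain : γ / 2 ≤
      ∑ i : Fin k, q i * ((a (Fin.castLE hkn i) : ℝ) - b (Fin.castLE hkn i)) ^ 2 / 2 := by
    refine le_trans (le_of_eq ?_) (Finset.single_le_sum (fun i _ => ?_) (Finset.mem_univ p))
    · rw [hp, ← hxlp, ← hxup]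
      ring
    · have := (hq i).le
      positivity
  have hqle : ∀ i, q i ≤ γ / g ^ 2 := fun i => by
    rw [le_div_iff₀ hg2pos]
    exact (mul_le_mul_of_nonneg_left (pow_le_pow_left₀ hg.le (hgap i) 2) (hq i).le).trans (hγmax i)
  have hloss : ∑ i : Fin k, q i * ((y (Fin.castLE hkn i) : ℝ) - z (Fin.castLE hkn i)) ^ 2 / 2 ≤
      k * (γ / g ^ 2 / 2) := by
    refine (Finset.sum_le_card_nsmul _ _ (γ / g ^ 2 / 2) fun i _ => ?_).trans_eq (by simp)
    have h1 : |(y (Fin.castLE hkn i) : ℝ) - z (Fin.castLE hkn i)| ≤ 1 := by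
      exact_mod_cast hyz1 (Fin.castLE hkn i)
    have h2 := (sq_le_one_iff_abs_le_one _).2 h1
    linarith [mul_le_of_le_one_right (hq i).le h2, hqle i]
  have hγ0 : 0 ≤ γ := hp ▸ mul_nonneg (hq p).le (sq_nonneg _)
  have hkey : γ * k / (4 * g ^ 2) ≤ ε * (γ / 4 - k * (γ / g ^ 2 / 4)) := by
    have h1 : k * (1 + ε) ≤ ε * g ^ 2 := by
      have := mul_le_mul_of_nonneg_left hg2 hε0.le
      have he : ε * (k * (1 + 1 / ε)) = k * (1 + ε) := by
        field_simp
        ring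
      linarith
    have h2 : ε * (γ / 4 - k * (γ / g ^ 2 / 4)) - γ * k / (4 * g ^ 2) =
        γ * (ε * g ^ 2 - k * (1 + ε)) / (4 * g ^ 2) := by
      field_simp
      ring
    have h3 : 0 ≤ γ * (ε * g ^ 2 - k * (1 + ε)) / (4 * g ^ 2) :=
      div_nonneg (mul_nonneg hγ0 (by linarith)) (by positivity)
    linarith
  have hex : ∃ xY ∈ S, f xd - f xstar ≤ ε * (f xY - f xstar) := by
    have hfinish : ∀ v ∈ S, γ / 4 - k * (γ / g ^ 2 / 4) ≤ f v - f xstar →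
        ∃ xY ∈ S, f xd - f xstar ≤ ε * (f xY - f xstar) := fun v hv hle =>
      ⟨v, hv, (hxd.trans hkey).trans (mul_le_mul_of_nonneg_left hle hε0.le)⟩
    rcases le_total (f fun i => (y i : ℝ)) (f fun i => (z i : ℝ)) with hle | hle
    · exact hfinish _ hz (by linarith)
    · exact hfinish _ hy (by linarith)
  refine ⟨hex, fun fmax _ hmax => ?_⟩
  obtain ⟨xY, hxY, hle⟩ := hex
  exact hle.trans (mul_le_mul_of_nonneg_left (sub_le_sub_right (hmax xY hxY) _) hε0.le)
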